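/- arXiv:math/0407464 — 6 statements merged into one kernel-verified Lean document; each statement's English description precedes it below -/
import Mathlib

section
/- Let k be a perfect field of characteristic p > 0, let R = k[x_1, ..., x_d], and let f ∈ R be a nonzero polynomial. Then there exists an integer n ≥ 1 such that f^(p^n − p) belongs to the ideal J_n(f^(p^n − 1)). -/
open MvPolynomial

noncomputable section

variable {k : Type*} [Field k] {d : ℕ}

/-- The divided-power (Hasse) differential operator `D_β` on `k[x_1,…,x_d]`,
determined on monomials by `D_β(x^γ) = (∏ i, choose (γ i) (β i)) x^(γ-β)`
(which is `0` unless `β ≤ γ`, since then some binomial coefficient vanishes). -/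
def Dop (β : Fin d →₀ ℕ) (f : MvPolynomial (Fin d) k) : MvPolynomial (Fin d) k :=
  ∑ γ ∈ f.support, (∏ i, (γ i).choose (β i)) • monomial (γ - β) (coeff γ f)

/-- The component `f_α(x^q)` in the decomposition `f = Σ_{0 ≤ α < q} f_α(x^q) x^α`
of `f` with respect to `x^q` (for `q = p^n`). -/
def Jcomp (q : ℕ) (f : MvPolynomial (Fin d) k) (α : Fin d →₀ ℕ) : MvPolynomial (Fin d) k :=
  ∑ γ ∈ f.support.filter (fun γ => ∀ i, γ i % q = α i), monomial (γ - α) (coeff γ f)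

/-- The ideal `J_n(f)` generated by the components `f_α(x^q)`, `0 ≤ α < q`, where `q = p^n`. -/
def Jideal (q : ℕ) (f : MvPolynomial (Fin d) k) : Ideal (MvPolynomial (Fin d) k) :=
  Ideal.span { g | ∃ α : Fin d →₀ ℕ, (∀ i, α i < q) ∧ g = Jcomp q f α }

/-- The ideal `I_n(f)` generated by the (unique, when they exist) `q`-th roots of the
components `f_α(x^q)`, `0 ≤ α < q`, where `q = p^n`. -/
def Iideal (q : ℕ) (f : MvPolynomial (Fin d) k) : Ideal (MvPolynomial (Fin d) k) :=
  Ideal.span { h | ∃ α : Fin d →₀ ℕ, (∀ i, α i < q) ∧ h ^ q = Jcomp q f α }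

/-- The Frobenius power `I^{[q]}` of an ideal `I`: the ideal generated by `q`-th powers
of elements of `I`. -/
def frobPow (I : Ideal (MvPolynomial (Fin d) k)) (q : ℕ) : Ideal (MvPolynomial (Fin d) k) :=
  Ideal.span ((fun x => x ^ q) '' (I : Set (MvPolynomial (Fin d) k)))

theorem coeff_Jcomp (q : ℕ) (f : MvPolynomial (Fin d) k) (α m : Fin d →₀ ℕ) :
    coeff m (Jcomp q f α) = if ∀ i, (m i + α i) % q = α i then coeff (m + α) f else 0 := by
  classical
  have hsub : ∀ γ ∈ f.support.filter (fun γ => ∀ i, γ i % q = α i),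
      coeff m (monomial (γ - α) (coeff γ f)) = if γ = m + α then coeff (m + α) f else 0 := by
    intro γ hγ
    have hle : α ≤ γ := fun i => ((Finset.mem_filter.1 hγ).2 i) ▸ Nat.mod_le _ _
    have hiff : γ - α = m ↔ γ = m + α := tsub_eq_iff_eq_add_of_le hle
    rw [coeff_monomial]
    by_cases h : γ = m + α
    · rw [if_pos (hiff.2 h), if_pos h, h]
    · rw [if_neg (mt hiff.1 h), if_neg h]
  rw [Jcomp, coeff_sum, Finset.sum_congr rfl hsub, Finset.sum_ite_eq']
  by_cases h : ∀ i, (m i + α i) % q = α i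
  · by_cases h0 : coeff (m + α) f = 0 <;> simp [h, h0]
  · simp [h]

theorem Jcomp_zero (q : ℕ) (α : Fin d →₀ ℕ) :
    Jcomp q (0 : MvPolynomial (Fin d) k) α = 0 := by
  simp [Jcomp]

theorem Jcomp_add (q : ℕ) (f g : MvPolynomial (Fin d) k) (α : Fin d →₀ ℕ) :
    Jcomp q (f + g) α = Jcomp q f α + Jcomp q g α := by
  ext m
  simp only [coeff_add, coeff_Jcomp]
  split_ifs <;> simp

theorem Jcomp_mul_monomial_nsmul {q : ℕ} (f : MvPolynomial (Fin d) k) {α : Fin d →₀ ℕ}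
    (hα : ∀ i, α i < q) (m : Fin d →₀ ℕ) (c : k) :
    Jcomp q (f * monomial (q • m) c) α = Jcomp q f α * monomial (q • m) c := by
  ext x
  simp only [coeff_Jcomp, coeff_mul_monomial']
  by_cases hx : q • m ≤ x
  · have hx' : q • m ≤ x + α := hx.trans le_self_add
    have hiff : (∀ i, (x i + α i) % q = α i) ↔ ∀ i, ((x - q • m) i + α i) % q = α i := by
      refine forall_congr' fun i => ?_
      have hi : q * m i ≤ x i := by simpa using hx i
      have he : x i + α i = (x - q • m) i + α i + q * m i := by simp; omega
      rw [he, Nat.add_mul_mod_self_left]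
    rw [if_pos hx', if_pos hx, tsub_add_eq_add_tsub hx]
    by_cases h : ∀ i, (x i + α i) % q = α i
    · rw [if_pos h, if_pos (hiff.1 h)]
    · rw [if_neg h, if_neg (mt hiff.2 h), zero_mul]
  · rw [if_neg hx]
    split_ifs with h hx'
    · refine absurd (fun i => ?_) hx
      have hq : 0 < q := (Nat.zero_le _).trans_lt (hα i)
      have hi : q * m i ≤ x i + α i := by simpa using hx' i
      have hdiv := Nat.div_add_mod (x i + α i) q
      rw [h i] at hdiv
      have hxi : x i = q * ((x i + α i) / q) := by omega
      have : m i ≤ (x i + α i) / q := by rw [Nat.le_div_iff_mul_le hq, mul_comm]; exact hi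
      calc (q • m) i = q * m i := by simp
        _ ≤ q * ((x i + α i) / q) := Nat.mul_le_mul_left q this
        _ = x i := hxi.symm
    · rfl
    · rfl

theorem Jcomp_mul_pow (p : ℕ) [Fact p.Prime] [CharP k p] (n : ℕ)
    (f h : MvPolynomial (Fin d) k) {α : Fin d →₀ ℕ} (hα : ∀ i, α i < p ^ n) :
    Jcomp (p ^ n) (f * h ^ p ^ n) α = Jcomp (p ^ n) f α * h ^ p ^ n := by
  induction h using MvPolynomial.induction_on' with
  | monomial m c => rw [monomial_pow, Jcomp_mul_monomial_nsmul f hα]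
  | add h₁ h₂ ih₁ ih₂ => rw [add_pow_char_pow, mul_add, mul_add, Jcomp_add, ih₁, ih₂]

theorem exists_pow_eq_Jcomp (p : ℕ) [Fact p.Prime] [CharP k p] [PerfectRing k p] (n : ℕ)
    (f : MvPolynomial (Fin d) k) (α : Fin d →₀ ℕ) :
    ∃ h : MvPolynomial (Fin d) k, h ^ p ^ n = Jcomp (p ^ n) f α := by
  refine ⟨∑ γ ∈ f.support.filter (fun γ => ∀ i, γ i % p ^ n = α i),
    monomial (γ.mapRange (· / p ^ n) (Nat.zero_div _))
      ((iterateFrobeniusEquiv k p n).symm (coeff γ f)), ?_⟩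
  rw [sum_pow_char_pow, Jcomp]
  refine Finset.sum_congr rfl fun γ hγ => ?_
  rw [monomial_pow, ← iterateFrobeniusEquiv_def k p n, RingEquiv.apply_symm_apply]
  congr 2
  ext i
  have := Nat.div_add_mod (γ i) (p ^ n)
  rw [(Finset.mem_filter.1 hγ).2 i] at this
  simp
  omega

theorem totalDegree_Jcomp_le (q : ℕ) (f : MvPolynomial (Fin d) k) (α : Fin d →₀ ℕ) :
    (Jcomp q f α).totalDegree ≤ f.totalDegree := by
  refine Finset.sup_le fun m hm => ?_
  rw [mem_support_iff, coeff_Jcomp] at hm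
  have hm' : m + α ∈ f.support := mem_support_iff.2 fun h => hm (by simp [h])
  refine le_trans ?_ (le_totalDegree hm')
  rw [Finsupp.sum_add_index' (fun _ => rfl) (fun _ _ _ => rfl)]
  exact Nat.le_add_right _ _

theorem totalDegree_pow_of_isDomain (h : MvPolynomial (Fin d) k) (n : ℕ) :
    (h ^ n).totalDegree = n * h.totalDegree := by
  by_cases h0 : h = 0
  · cases n <;> simp [h0]
  · induction n with
    | zero => simp
    | succ n ih =>
      rw [pow_succ, totalDegree_mul_of_isDomain (pow_ne_zero n h0) h0, ih, Nat.succ_mul]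

theorem totalDegree_root_le {q : ℕ} (hq : 0 < q) {f h : MvPolynomial (Fin d) k}
    {α : Fin d →₀ ℕ} (hh : h ^ q = Jcomp q (f ^ (q - 1)) α) :
    h.totalDegree ≤ f.totalDegree := by
  refine Nat.le_of_mul_le_mul_left ?_ hq
  rw [← totalDegree_pow_of_isDomain, hh]
  exact (totalDegree_Jcomp_le _ _ _).trans
    ((totalDegree_pow _ _).trans (Nat.mul_le_mul_right _ (Nat.sub_le _ _)))

theorem mem_frobPow_Iideal (p : ℕ) [Fact p.Prime] [CharP k p] [PerfectRing k p] (n : ℕ)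
    (f : MvPolynomial (Fin d) k) : f ∈ frobPow (Iideal (p ^ n) f) (p ^ n) := by
  classical
  have hq : 0 < p ^ n := pow_pos (Fact.out : p.Prime).pos n
  let r : (Fin d →₀ ℕ) → (Fin d →₀ ℕ) := fun γ => γ.mapRange (· % p ^ n) (Nat.zero_mod _)
  have hsum : f = ∑ α ∈ f.support.image r, Jcomp (p ^ n) f α * monomial α 1 := by
    conv_lhs => rw [f.as_sum,
      ← Finset.sum_fiberwise_of_maps_to (fun γ hγ => Finset.mem_image_of_mem r hγ)]
    refine Finset.sum_congr rfl fun α _ => ?_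
    have hfilter : f.support.filter (fun γ => r γ = α) =
        f.support.filter (fun γ => ∀ i, γ i % p ^ n = α i) :=
      Finset.filter_congr fun γ _ => by simp [r, Finsupp.ext_iff]
    rw [hfilter, Jcomp, Finset.sum_mul]
    refine Finset.sum_congr rfl fun γ hγ => ?_
    have hle : α ≤ γ := fun i => ((Finset.mem_filter.1 hγ).2 i) ▸ Nat.mod_le _ _
    rw [monomial_mul, mul_one, tsub_add_cancel_of_le hle]
  refine (congrArg (· ∈ frobPow (Iideal (p ^ n) f) (p ^ n)) hsum).mpr ?_
  refine Ideal.sum_mem _ fun α hα => Ideal.mul_mem_right _ _ ?_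
  obtain ⟨γ, -, rfl⟩ := Finset.mem_image.1 hα
  obtain ⟨h, hh⟩ := exists_pow_eq_Jcomp p n f (r γ)
  rw [← hh]
  exact Ideal.subset_span ⟨h, Ideal.subset_span ⟨r γ, fun i => Nat.mod_lt _ hq, hh⟩, rfl⟩

theorem Iideal_le_of_mem_frobPow (p : ℕ) [Fact p.Prime] [CharP k p] [PerfectRing k p] (n : ℕ)
    {f : MvPolynomial (Fin d) k} {I : Ideal (MvPolynomial (Fin d) k)}
    (hf : f ∈ frobPow I (p ^ n)) : Iideal (p ^ n) f ≤ I := by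
  refine Ideal.span_le.2 ?_
  rintro h ⟨α, hα, hh⟩
  have key : ∃ g ∈ I, g ^ p ^ n = Jcomp (p ^ n) f α := by
    clear hh
    induction hf using Submodule.closure_induction with
    | zero =>
      exact ⟨0, I.zero_mem, by
        rw [Jcomp_zero, zero_pow (pow_pos (Fact.out : p.Prime).pos n).ne']⟩
    | add x y _ _ hx hy =>
      obtain ⟨a, ha, hax⟩ := hx
      obtain ⟨b, hb, hby⟩ := hy
      exact ⟨a + b, I.add_mem ha hb, by rw [add_pow_char_pow, Jcomp_add, hax, hby]⟩
    | smul_mem r x hx =>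
      obtain ⟨a, ha, rfl⟩ := hx
      obtain ⟨s, hs⟩ := exists_pow_eq_Jcomp p n r α
      exact ⟨s * a, I.mul_mem_left s ha, by
        rw [smul_eq_mul, Jcomp_mul_pow p n r a hα, mul_pow, hs]⟩
  obtain ⟨g, hg, hgh⟩ := key
  have : h = g := iterateFrobenius_inj (MvPolynomial (Fin d) k) p n (by
    simp only [iterateFrobenius_def]
    rw [hh, hgh])
  rwa [this]

theorem pow_mem_of_mem_frobPow (p : ℕ) [Fact p.Prime] [CharP k p] (q : ℕ)
    {I J : Ideal (MvPolynomial (Fin d) k)} (hIJ : ∀ h ∈ I, h ^ (q * p) ∈ J)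
    {x : MvPolynomial (Fin d) k} (hx : x ∈ frobPow I q) : x ^ p ∈ J := by
  have hle : frobPow I q ≤ J.comap (frobenius (MvPolynomial (Fin d) k) p) := by
    refine Ideal.span_le.2 ?_
    rintro _ ⟨h, hh, rfl⟩
    simpa [frobenius_def, pow_mul] using hIJ h hh
  simpa [frobenius_def] using hle hx

theorem pow_mem_Jideal_of_mem_Iideal (p : ℕ) [Fact p.Prime] [CharP k p] (n : ℕ)
    {f h : MvPolynomial (Fin d) k} (hh : h ∈ Iideal (p ^ n) f) :
    h ^ p ^ n ∈ Jideal (p ^ n) f := by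
  have hle : Iideal (p ^ n) f ≤
      (Jideal (p ^ n) f).comap (iterateFrobenius (MvPolynomial (Fin d) k) p n) := by
    refine Ideal.span_le.2 ?_
    rintro g ⟨α, hα, hg⟩
    exact Ideal.subset_span ⟨α, hα, hg⟩
  exact hle hh

theorem Iideal_pow_sub_one_succ_le (p : ℕ) [Fact p.Prime] [CharP k p] [PerfectRing k p]
    (f : MvPolynomial (Fin d) k) (n : ℕ) :
    Iideal (p ^ (n + 1)) (f ^ (p ^ (n + 1) - 1)) ≤ Iideal (p ^ n) (f ^ (p ^ n - 1)) := by
  refine Iideal_le_of_mem_frobPow p (n + 1) ?_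
  have hp := (Fact.out : p.Prime).pos
  have hexp : p ^ (n + 1) - 1 = (p ^ n - 1) * p + (p - 1) := by
    have h1 : 1 * p ≤ p ^ n * p := Nat.mul_le_mul_right p (pow_pos hp n)
    rw [pow_succ, Nat.sub_mul]
    omega
  rw [hexp, pow_add f, pow_mul f]
  refine Ideal.mul_mem_right _ _ (pow_mem_of_mem_frobPow p (p ^ n) (fun h hh => ?_)
    (mem_frobPow_Iideal p n (f ^ (p ^ n - 1))))
  rw [← pow_succ]
  exact Ideal.subset_span ⟨h, hh, rfl⟩

theorem exists_Iideal_pow_sub_one_le_succ (p : ℕ) [Fact p.Prime] [CharP k p] [PerfectRing k p]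
    (f : MvPolynomial (Fin d) k) :
    ∃ n, Iideal (p ^ n) (f ^ (p ^ n - 1)) ≤ Iideal (p ^ (n + 1)) (f ^ (p ^ (n + 1) - 1)) := by
  let V := restrictTotalDegree (Fin d) k f.totalDegree
  let A : ℕ → Ideal (MvPolynomial (Fin d) k) := fun n => Iideal (p ^ n) (f ^ (p ^ n - 1))
  let W : ℕ →o (Submodule k V)ᵒᵈ :=
    { toFun := fun n => OrderDual.toDual (((A n).restrictScalars k).comap V.subtype)
      monotone' := monotone_nat_of_le_succ fun n =>
        OrderDual.toDual_le_toDual.2 fun _ hx => Iideal_pow_sub_one_succ_le p f n hx }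
  obtain ⟨n, hn⟩ := IsArtinian.monotone_stabilizes W
  refine ⟨n, Ideal.span_le.2 ?_⟩
  rintro h ⟨α, hα, hh⟩
  have hV : h ∈ V := (mem_restrictTotalDegree _ _ _).2
    (totalDegree_root_le (pow_pos (Fact.out : p.Prime).pos n) hh)
  have hmem : (⟨h, hV⟩ : V) ∈ OrderDual.ofDual (W n) :=
    show h ∈ A n from Ideal.subset_span ⟨α, hα, hh⟩
  rw [hn (n + 1) n.le_succ] at hmem
  exact hmem

/-- for a nonzero polynomial `f` over a perfect field of characteristic `p > 0`,
there is `n ≥ 1` with `f^(p^n - p) ∈ J_n(f^(p^n - 1))`. -/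
theorem stmt0 (p : ℕ) [Fact p.Prime] (k : Type*) [Field k] [CharP k p] [PerfectRing k p]
    (d : ℕ) (f : MvPolynomial (Fin d) k) (hf : f ≠ 0) :
    ∃ n : ℕ, 1 ≤ n ∧ f ^ (p ^ n - p) ∈ Jideal (p ^ n) (f ^ (p ^ n - 1)) := by
  obtain ⟨n, hn⟩ := exists_Iideal_pow_sub_one_le_succ p f
  refine ⟨n + 1, Nat.le_add_left 1 n, ?_⟩
  have hexp : p ^ (n + 1) - p = (p ^ n - 1) * p := by rw [pow_succ, Nat.sub_mul, one_mul]
  rw [hexp, pow_mul]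
  refine pow_mem_of_mem_frobPow p (p ^ n) (fun h hh => ?_)
    (mem_frobPow_Iideal p n (f ^ (p ^ n - 1)))
  rw [← pow_succ]
  exact pow_mem_Jideal_of_mem_Iideal p (n + 1) (hn hh)
end
end

section
/- Let k be a perfect field of characteristic p > 0, let R = k[x_1, ..., x_d], and let f ∈ R be a nonzero polynomial. Then there exist an integer n ≥ 1 and a k-linear operator Q on R of the form Q = Σ_{α,β} a_{αβ} x^α D_β, a finite sum with a_{αβ} ∈ k and every multi-index β having all components strictly less than p^n, such that Q(f^(p^n − 1)) = f^(p^n − p). -/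
open MvPolynomial

noncomputable section

variable {k : Type*} [Field k] {d : ℕ}

open Finset in
/-- The exponents in `ℕ^d` all of whose components are less than `q`. -/
def expBox (d q : ℕ) : Finset (Fin d →₀ ℕ) :=
  (Fintype.piFinset fun _ : Fin d => range q).map Finsupp.equivFunOnFinite.symm.toEmbedding

lemma mem_expBox {q : ℕ} {α : Fin d →₀ ℕ} : α ∈ expBox d q ↔ ∀ i, α i < q := by
  simp only [expBox, Finset.mem_map_equiv, Equiv.symm_symm, Fintype.mem_piFinset, Finset.mem_range]
  rfl

open Finset in
lemma sum_expBox_prod (q : ℕ) (F : Fin d → ℕ → k) :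
    ∑ β ∈ expBox d q, ∏ i, F i (β i) = ∏ i, ∑ b ∈ range q, F i b := by
  rw [prod_univ_sum, expBox, sum_map]
  rfl

/-- The componentwise quotient of an exponent by `q`. -/
def divExp (q : ℕ) (γ : Fin d →₀ ℕ) : Fin d →₀ ℕ := γ.mapRange (· / q) (Nat.zero_div q)

/-- The componentwise remainder of an exponent modulo `q`. -/
def modExp (q : ℕ) (γ : Fin d →₀ ℕ) : Fin d →₀ ℕ := γ.mapRange (· % q) (Nat.zero_mod q)

@[simp] lemma divExp_apply (q : ℕ) (γ : Fin d →₀ ℕ) (i : Fin d) : divExp q γ i = γ i / q := rfl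

@[simp] lemma modExp_apply (q : ℕ) (γ : Fin d →₀ ℕ) (i : Fin d) : modExp q γ i = γ i % q := rfl

lemma smul_divExp_add_modExp (q : ℕ) (γ : Fin d →₀ ℕ) : q • divExp q γ + modExp q γ = γ := by
  ext i
  simp [Nat.div_add_mod]

lemma modExp_mem_expBox {q : ℕ} (hq : 0 < q) (γ : Fin d →₀ ℕ) : modExp q γ ∈ expBox d q :=
  mem_expBox.2 fun _ => Nat.mod_lt _ hq

lemma smul_add_eq_iff {q : ℕ} {α : Fin d →₀ ℕ} (hα : α ∈ expBox d q) (δ γ : Fin d →₀ ℕ) :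
    q • δ + α = γ ↔ divExp q γ = δ ∧ modExp q γ = α := by
  rw [mem_expBox] at hα
  constructor
  · rintro rfl
    constructor <;> ext i <;> have := hα i
    · simp [Nat.mul_add_div (Nat.zero_lt_of_lt this), Nat.div_eq_of_lt this]
    · simp [Nat.mod_eq_of_lt this]
  · rintro ⟨rfl, rfl⟩
    exact smul_divExp_add_modExp q γ

lemma smul_add_injective {q : ℕ} (hq : q ≠ 0) (α : Fin d →₀ ℕ) :
    Function.Injective fun δ : Fin d →₀ ℕ => q • δ + α := fun δ ε h => by
  ext i
  simpa [hq] using DFunLike.congr_fun h i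

lemma pow_pow_succ_sub_one {M : Type*} [Monoid M] {p : ℕ} (hp : 0 < p) (n : ℕ) (f : M) :
    f ^ (p ^ (n + 1) - 1) = f ^ (p - 1) * (f ^ (p ^ n - 1)) ^ p := by
  have hpn : p ≤ p ^ n * p := Nat.le_mul_of_pos_left p (pow_pos hp n)
  rw [← pow_mul, ← pow_add, Nat.sub_mul, one_mul, pow_succ]
  congr 1
  omega

section Cartier

variable (p : ℕ) [Fact p.Prime] [CharP k p]

section PerfectRing

variable [PerfectRing k p]

/-- The polynomial whose coefficient at `δ` is the `p^n`-th root of the coefficient of `g` at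
`p^n δ + α`. -/
def cartierFun (n : ℕ) (α : Fin d →₀ ℕ) (g : MvPolynomial (Fin d) k) : MvPolynomial (Fin d) k :=
  ∑ δ ∈ g.support.preimage (fun δ => p ^ n • δ + α) (smul_add_injective
      (pow_ne_zero n (Fact.out : p.Prime).ne_zero) α).injOn,
    monomial δ ((iterateFrobeniusEquiv k p n).symm (coeff (p ^ n • δ + α) g))

lemma coeff_cartierFun (n : ℕ) (α : Fin d →₀ ℕ) (g : MvPolynomial (Fin d) k) (ε : Fin d →₀ ℕ) :
    coeff ε (cartierFun p n α g) =
      (iterateFrobeniusEquiv k p n).symm (coeff (p ^ n • ε + α) g) := by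
  simp only [cartierFun, coeff_sum, coeff_monomial, Finset.sum_ite_eq', Finset.mem_preimage]
  split_ifs with h
  · rfl
  · rw [notMem_support_iff.1 h, map_zero]

/-- The `p^(-n)`-linear map sending `Σ_{α < p^n} g_α^(p^n) x^α` to `g_α`. -/
def cartierMap (n : ℕ) (α : Fin d →₀ ℕ) : MvPolynomial (Fin d) k →+ MvPolynomial (Fin d) k :=
  AddMonoidHom.mk' (cartierFun p n α) fun g h => by
    ext ε
    simp only [coeff_cartierFun, coeff_add, map_add]

lemma coeff_cartierMap (n : ℕ) (α : Fin d →₀ ℕ) (g : MvPolynomial (Fin d) k) (ε : Fin d →₀ ℕ) :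
    coeff ε (cartierMap p n α g) =
      (iterateFrobeniusEquiv k p n).symm (coeff (p ^ n • ε + α) g) :=
  coeff_cartierFun p n α g ε

lemma cartierMap_monomial {n : ℕ} {α : Fin d →₀ ℕ} (hα : α ∈ expBox d (p ^ n))
    (γ : Fin d →₀ ℕ) (c : k) :
    cartierMap p n α (monomial γ c) =
      if modExp (p ^ n) γ = α then
        monomial (divExp (p ^ n) γ) ((iterateFrobeniusEquiv k p n).symm c) else 0 := by
  ext ε
  rw [coeff_cartierMap, coeff_monomial]
  by_cases h : modExp (p ^ n) γ = α
  · simp only [eq_comm (a := γ), smul_add_eq_iff hα, h, and_true, if_true, coeff_monomial]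
    split_ifs <;> simp
  · simp [eq_comm (a := γ), smul_add_eq_iff hα, h]

lemma cartierMap_monomial_pow {n : ℕ} {α : Fin d →₀ ℕ} (hα : α ∈ expBox d (p ^ n))
    (γ : Fin d →₀ ℕ) (c : k) :
    cartierMap p n α (monomial γ c) ^ p ^ n =
      if modExp (p ^ n) γ = α then monomial (γ - α) c else 0 := by
  have hp : p ^ n ≠ 0 := pow_ne_zero _ (Fact.out : p.Prime).ne_zero
  rw [cartierMap_monomial p hα]
  split_ifs with h
  · have hc : (iterateFrobeniusEquiv k p n).symm c ^ p ^ n = c :=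
      (iterateFrobeniusEquiv k p n).apply_symm_apply c
    rw [monomial_pow, hc, ← h]
    congr 2
    exact (tsub_eq_of_eq_add (smul_divExp_add_modExp _ γ).symm).symm
  · exact zero_pow hp

lemma cartierMap_pow_mul {n : ℕ} {α : Fin d →₀ ℕ} (hα : α ∈ expBox d (p ^ n))
    (r s : MvPolynomial (Fin d) k) :
    cartierMap p n α (r ^ p ^ n * s) = r * cartierMap p n α s := by
  have hp : 0 < p ^ n := pow_pos (Fact.out : p.Prime).pos _
  induction r using MvPolynomial.induction_on' with
  | add r₁ r₂ h₁ h₂ => rw [add_pow_char_pow, add_mul, map_add, h₁, h₂, add_mul]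
  | monomial m a =>
    induction s using MvPolynomial.induction_on' with
    | add s₁ s₂ h₁ h₂ => rw [mul_add, map_add, h₁, h₂, map_add, mul_add]
    | monomial γ c =>
      have ha : (iterateFrobeniusEquiv k p n).symm (a ^ p ^ n) = a :=
        (iterateFrobeniusEquiv k p n).symm_apply_apply a
      have hmod : modExp (p ^ n) (p ^ n • m + γ) = modExp (p ^ n) γ := by
        ext i
        simp
      have hdiv : divExp (p ^ n) (p ^ n • m + γ) = m + divExp (p ^ n) γ := by
        ext i
        simp [Nat.mul_add_div hp]
      rw [monomial_pow, monomial_mul, cartierMap_monomial p hα, cartierMap_monomial p hα, hmod,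
        hdiv, map_mul, ha, mul_ite, mul_zero, monomial_mul]

lemma sum_monomial_mul_cartierMap_pow (n : ℕ) (g : MvPolynomial (Fin d) k) :
    ∑ α ∈ expBox d (p ^ n), cartierMap p n α g ^ p ^ n * monomial α 1 = g := by
  induction g using MvPolynomial.induction_on' with
  | add g₁ g₂ h₁ h₂ =>
    simp only [map_add, add_pow_char_pow, add_mul, Finset.sum_add_distrib, h₁, h₂]
  | monomial γ c =>
    have hγ := modExp_mem_expBox (pow_pos (Fact.out : p.Prime).pos n) γ
    rw [Finset.sum_eq_single_of_mem _ hγ, cartierMap_monomial_pow p hγ, if_pos rfl, monomial_mul,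
      mul_one]
    · rw [tsub_add_cancel_of_le]
      exact fun i => Nat.mod_le _ _
    · intro α hα hne
      rw [cartierMap_monomial_pow p hα, if_neg hne.symm, zero_mul]

lemma totalDegree_cartierMap_le (n : ℕ) (α : Fin d →₀ ℕ) (g : MvPolynomial (Fin d) k) {N : ℕ}
    (hg : g.totalDegree ≤ p ^ n * N) : (cartierMap p n α g).totalDegree ≤ N := by
  have hp : 0 < p ^ n := pow_pos (Fact.out : p.Prime).pos _
  refine Finset.sup_le fun ε hε => ?_
  rw [mem_support_iff, coeff_cartierMap] at hε
  have hmem : p ^ n • ε + α ∈ g.support :=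
    mem_support_iff.2 fun h => hε (by rw [h, map_zero])
  have h := (le_totalDegree hmem).trans hg
  change (p ^ n • ε + α).degree ≤ _ at h
  rw [map_add, map_nsmul, smul_eq_mul] at h
  exact Nat.le_of_mul_le_mul_left (le_of_add_le_left h) hp

/-- The ideal generated by the `p^n`-th roots of the components of `g`. -/
def cartierIdeal (n : ℕ) (g : MvPolynomial (Fin d) k) : Ideal (MvPolynomial (Fin d) k) :=
  Ideal.span ((fun α => cartierMap p n α g) '' expBox d (p ^ n))

lemma map_mem_cartierIdeal {n : ℕ} (φ : MvPolynomial (Fin d) k →+ MvPolynomial (Fin d) k)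
    (hφ : ∀ r s, φ (r ^ p ^ n * s) = r * φ s) (g : MvPolynomial (Fin d) k) :
    φ g ∈ cartierIdeal p n g := by
  rw [← sum_monomial_mul_cartierMap_pow p n g, map_sum, sum_monomial_mul_cartierMap_pow p n g]
  refine sum_mem fun α hα => ?_
  rw [hφ]
  exact Ideal.mul_mem_right _ _ (Ideal.subset_span ⟨α, hα, rfl⟩)

lemma cartierIdeal_succ_le (n : ℕ) (f g : MvPolynomial (Fin d) k) :
    cartierIdeal p (n + 1) (f * g ^ p) ≤ cartierIdeal p n g := by
  refine Ideal.span_le.2 ?_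
  rintro _ ⟨α, hα, rfl⟩
  let φ : MvPolynomial (Fin d) k →+ MvPolynomial (Fin d) k :=
    AddMonoidHom.mk' (fun s => cartierMap p (n + 1) α (f * s ^ p)) fun r s => by
      rw [add_pow_char, mul_add, map_add]
  refine map_mem_cartierIdeal p φ (fun r s => ?_) g
  simp only [φ, AddMonoidHom.mk'_apply]
  rw [← cartierMap_pow_mul p hα, mul_pow, ← pow_mul, ← pow_succ, mul_left_comm]

lemma exists_cartierIdeal_stable (f : MvPolynomial (Fin d) k) :
    ∃ n, cartierIdeal p n (f ^ (p ^ n - 1)) ≤ cartierIdeal p (n + 1) (f ^ (p ^ (n + 1) - 1)) := by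
  let W := restrictTotalDegree (Fin d) k f.totalDegree
  let V (n : ℕ) : Submodule k W :=
    ((cartierIdeal p n (f ^ (p ^ n - 1))).restrictScalars k).comap W.subtype
  have hV : Antitone V := antitone_nat_of_succ_le fun n => by
    refine Submodule.comap_mono fun x hx => ?_
    rw [Submodule.restrictScalars_mem, pow_pow_succ_sub_one (Fact.out : p.Prime).pos] at hx
    exact cartierIdeal_succ_le p n _ _ hx
  obtain ⟨n, hn⟩ := IsArtinian.monotone_stabilizes (R := k) (M := W)
    ⟨fun n => OrderDual.toDual (V n), hV⟩
  refine ⟨n, Ideal.span_le.2 ?_⟩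
  rintro _ ⟨α, hα, rfl⟩
  have hdeg : (cartierMap p n α (f ^ (p ^ n - 1))).totalDegree ≤ f.totalDegree :=
    totalDegree_cartierMap_le p n α _ <| (totalDegree_pow _ _).trans <|
      Nat.mul_le_mul_right _ (Nat.sub_le _ _)
  have hmem : (⟨cartierMap p n α (f ^ (p ^ n - 1)), (mem_restrictTotalDegree _ _ _).2 hdeg⟩ : W) ∈
      V n := Ideal.subset_span ⟨α, hα, rfl⟩
  have hVn : V n = V (n + 1) := hn (n + 1) n.le_succ
  rw [hVn] at hmem
  exact hmem

end PerfectRing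

lemma choose_mod_pow_cast (n m b : ℕ) (hb : b < p ^ n) :
    ((m.choose b : ℕ) : k) = ((m % p ^ n).choose b : ℕ) := by
  have hadd (m : ℕ) : (((p ^ n + m).choose b : ℕ) : k) = (m.choose b : ℕ) := by
    rw [Nat.add_choose_eq, Nat.cast_sum, Finset.sum_eq_single_of_mem (0, b) (by simp)]
    · simp
    · rintro ⟨i, j⟩ hij hne
      have hsum : i + j = b := Finset.HasAntidiagonal.mem_antidiagonal.1 hij
      have hi : i ≠ 0 := by
        rintro rfl
        exact hne (by rw [← hsum, zero_add])
      have := (Fact.out : p.Prime).dvd_choose_pow hi (n := n) (by omega)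
      rw [Nat.cast_mul, (CharP.cast_eq_zero_iff k p _).2 this, zero_mul]
  have hmul (t m : ℕ) : (((p ^ n * t + m).choose b : ℕ) : k) = (m.choose b : ℕ) := by
    induction t with
    | zero => simp
    | succ t ih => rw [mul_add, mul_one, add_comm (p ^ n * t), add_assoc, hadd, ih]
  conv_lhs => rw [← Nat.div_add_mod m (p ^ n), hmul]

lemma sum_choose_mul_coeff_X_sub_one_pow (n m a : ℕ) :
    ∑ b ∈ Finset.range (p ^ n), (m.choose b : k) * ((Polynomial.X - 1 : Polynomial k) ^ b).coeff a =
      if m % p ^ n = a then 1 else 0 := by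
  have hp : 0 < p ^ n := pow_pos (Fact.out : p.Prime).pos _
  have hm : m % p ^ n + 1 ≤ p ^ n := Nat.mod_lt m hp
  have hX : (Polynomial.X : Polynomial k) ^ (m % p ^ n) =
      ∑ b ∈ Finset.range (p ^ n),
        (((m % p ^ n).choose b : ℕ) : Polynomial k) * (Polynomial.X - 1) ^ b := by
    conv_lhs => rw [← sub_add_cancel (Polynomial.X : Polynomial k) 1, add_pow]
    refine Finset.sum_subset_zero_on_sdiff (Finset.range_mono hm) (fun b hb => ?_)
      fun b _ => by rw [one_pow, mul_one, mul_comm]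
    rw [Finset.mem_sdiff, Finset.mem_range, Finset.mem_range] at hb
    rw [Nat.choose_eq_zero_of_lt (by omega), Nat.cast_zero, zero_mul]
  have h := congrArg (Polynomial.coeff · a) hX
  simp only [Polynomial.coeff_X_pow, Polynomial.finsetSum_coeff, Polynomial.coeff_natCast_mul] at h
  simp only [eq_comm (a := m % p ^ n), h]
  exact Finset.sum_congr rfl fun b hb => by
    rw [choose_mod_pow_cast p n m b (Finset.mem_range.1 hb)]

end Cartier

lemma Dop_monomial (β γ : Fin d →₀ ℕ) (c : k) :
    Dop β (monomial γ c) = (∏ i, (γ i).choose (β i)) • monomial (γ - β) c := by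
  classical
  by_cases hc : c = 0
  · simp [Dop, hc]
  · simp [Dop, support_monomial, hc]

lemma Dop_add (β : Fin d →₀ ℕ) (f g : MvPolynomial (Fin d) k) :
    Dop β (f + g) = Dop β f + Dop β g := by
  classical
  have hext (h : MvPolynomial (Fin d) k) (hs : h.support ⊆ f.support ∪ g.support) :
      Dop β h = ∑ γ ∈ f.support ∪ g.support,
        (∏ i, (γ i).choose (β i)) • monomial (γ - β) (coeff γ h) :=
    Finset.sum_subset hs fun γ _ hγ => by rw [notMem_support_iff.1 hγ, map_zero, smul_zero]
  rw [hext _ support_add, hext f Finset.subset_union_left, hext g Finset.subset_union_right,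
    ← Finset.sum_add_distrib]
  simp only [coeff_add, map_add, smul_add]

lemma cartierMap_pow_eq_sum_Dop (p : ℕ) [Fact p.Prime] [CharP k p] [PerfectRing k p] {n : ℕ}
    {α : Fin d →₀ ℕ} (hα : α ∈ expBox d (p ^ n)) (g : MvPolynomial (Fin d) k) :
    cartierMap p n α g ^ p ^ n = ∑ β ∈ expBox d (p ^ n),
      monomial (β - α) (∏ i, ((Polynomial.X - 1 : Polynomial k) ^ β i).coeff (α i)) * Dop β g := by
  induction g using MvPolynomial.induction_on' with
  | add g₁ g₂ h₁ h₂ =>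
    simp only [map_add, add_pow_char_pow, Dop_add, mul_add, Finset.sum_add_distrib, h₁, h₂]
  | monomial γ c =>
    have hterm (β : Fin d →₀ ℕ) :
        monomial (β - α) (∏ i, ((Polynomial.X - 1 : Polynomial k) ^ β i).coeff (α i)) *
          Dop β (monomial γ c) =
        monomial (γ - α) ((∏ i, ((γ i).choose (β i) : k) *
          ((Polynomial.X - 1 : Polynomial k) ^ β i).coeff (α i)) * c) := by
      rw [Dop_monomial, ← map_nsmul, monomial_mul, Finset.prod_mul_distrib, nsmul_eq_mul,
        Nat.cast_prod]
      by_cases hle : α ≤ β ∧ β ≤ γ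
      · rw [add_comm, tsub_add_tsub_cancel hle.2 hle.1]
        congr 1
        ring
      · rw [not_and_or, Finsupp.le_def, Finsupp.le_def, not_forall, not_forall] at hle
        obtain ⟨i, hi⟩ | ⟨i, hi⟩ := hle
        · have h0 : ((Polynomial.X - 1 : Polynomial k) ^ β i).coeff (α i) = 0 := by
            refine Polynomial.coeff_eq_zero_of_natDegree_lt (lt_of_le_of_lt ?_ (not_le.1 hi))
            simpa using Polynomial.natDegree_pow_le_of_le (β i)
              (Polynomial.natDegree_X_sub_C_le (1 : k))
          rw [Finset.prod_eq_zero (Finset.mem_univ i) h0]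
          simp
        · have h0 : ((γ i).choose (β i) : k) = 0 := by
            rw [Nat.choose_eq_zero_of_lt (not_le.1 hi), Nat.cast_zero]
          rw [Finset.prod_eq_zero (f := fun i => ((γ i).choose (β i) : k)) (Finset.mem_univ i) h0]
          simp
    simp only [hterm]
    rw [← map_sum, ← Finset.sum_mul,
      sum_expBox_prod (p ^ n) fun i b =>
        ((γ i).choose b : k) * ((Polynomial.X - 1 : Polynomial k) ^ b).coeff (α i),
      cartierMap_monomial_pow p hα]
    simp only [sum_choose_mul_coeff_X_sub_one_pow]
    split_ifs with h
    · rw [← h, Finset.prod_eq_one fun i _ => if_pos (modExp_apply _ γ i).symm, one_mul]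
    · obtain ⟨i, hi⟩ := not_forall.1 fun h' => h (Finsupp.ext h')
      rw [Finset.prod_eq_zero (Finset.mem_univ i) (if_neg hi), zero_mul, map_zero]

/-- Membership in the ideal generated by the `D_β g`, `β < q`, is realised by a differential
operator of the corresponding level. -/
lemma exists_operator_of_mem_span {q : ℕ} {g h : MvPolynomial (Fin d) k}
    (hh : h ∈ Ideal.span ((fun β => Dop β g) '' expBox d q)) :
    ∃ (S : Finset ((Fin d →₀ ℕ) × (Fin d →₀ ℕ))) (a : (Fin d →₀ ℕ) × (Fin d →₀ ℕ) → k),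
      (∀ αβ ∈ S, ∀ i, αβ.2 i < q) ∧
      ∑ αβ ∈ S, a αβ • (monomial αβ.1 (1 : k) * Dop αβ.2 g) = h := by
  classical
  obtain ⟨r, hr, rfl⟩ := (Finsupp.mem_span_image_iff_linearCombination _).1 hh
  rw [Finsupp.mem_supported] at hr
  refine ⟨r.support.biUnion (fun β => (r β).support) ×ˢ r.support, fun αβ => coeff αβ.1 (r αβ.2),
    fun αβ h => mem_expBox.1 (hr (Finset.mem_product.1 h).2), ?_⟩
  rw [Finset.sum_product_right, Finsupp.linearCombination_apply, Finsupp.sum]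
  refine Finset.sum_congr rfl fun β hβ => ?_
  conv_rhs => rw [(r β).as_sum, smul_eq_mul, Finset.sum_mul]
  refine (Finset.sum_subset (Finset.subset_biUnion_of_mem (fun β => (r β).support) hβ)
    fun α _ hα => ?_).symm.trans (Finset.sum_congr rfl fun α _ => ?_)
  · simp only [notMem_support_iff.1 hα, zero_smul]
  · rw [← smul_mul_assoc, smul_monomial, smul_eq_mul, mul_one]

/-- there are `n ≥ 1` and a `k`-linear operator `Q = Σ a_{αβ} x^α D_β`
(finite sum, all `β < p^n` componentwise) with `Q(f^(p^n - 1)) = f^(p^n - p)`. -/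
theorem stmt1 (p : ℕ) [Fact p.Prime] (k : Type*) [Field k] [CharP k p] [PerfectRing k p]
    (d : ℕ) (f : MvPolynomial (Fin d) k) (hf : f ≠ 0) :
    ∃ n : ℕ, 1 ≤ n ∧
      ∃ (S : Finset ((Fin d →₀ ℕ) × (Fin d →₀ ℕ))) (a : (Fin d →₀ ℕ) × (Fin d →₀ ℕ) → k),
        (∀ αβ ∈ S, ∀ i, αβ.2 i < p ^ n) ∧
        ∑ αβ ∈ S, a αβ • (monomial αβ.1 (1 : k) * Dop αβ.2 (f ^ (p ^ n - 1)))
          = f ^ (p ^ n - p) := by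
  obtain ⟨n, hn⟩ := exists_cartierIdeal_stable p f
  refine ⟨n + 1, n.succ_pos, exists_operator_of_mem_span ?_⟩
  have hroot : cartierIdeal p (n + 1) (f ^ (p ^ (n + 1) - 1)) ≤
      (Ideal.span ((fun β => Dop β (f ^ (p ^ (n + 1) - 1))) '' expBox d (p ^ (n + 1)))).comap
        (iterateFrobenius (MvPolynomial (Fin d) k) p (n + 1)) := by
    refine Ideal.span_le.2 ?_
    rintro _ ⟨α, hα, rfl⟩
    rw [SetLike.mem_coe, Ideal.mem_comap, iterateFrobenius_def, cartierMap_pow_eq_sum_Dop p hα]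
    exact sum_mem fun β hβ => Ideal.mul_mem_left _ _ (Ideal.subset_span ⟨β, hβ, rfl⟩)
  have hf_pow : f ^ (p ^ (n + 1) - p) = frobenius (MvPolynomial (Fin d) k) p (f ^ (p ^ n - 1)) := by
    rw [frobenius_def, ← pow_mul, Nat.sub_mul, one_mul, pow_succ]
  rw [hf_pow, ← sum_monomial_mul_cartierMap_pow p n (f ^ (p ^ n - 1)), map_sum]
  refine sum_mem fun α hα => ?_
  rw [map_mul, frobenius_def, ← pow_mul, ← pow_succ]
  exact Ideal.mul_mem_right _ _ (hroot (hn (Ideal.subset_span ⟨α, hα, rfl⟩)))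
end
end

section
/- Let k be a field of characteristic p > 0, let R = k[x_1, ..., x_d], and let n ≥ 1. If f, g ∈ R satisfy f = g^p, then J_n(f) equals the Frobenius power J_{n−1}(g)^{[p]}. -/
open MvPolynomial

noncomputable section

variable {k : Type*} [Field k] {d : ℕ}

theorem Jcomp_eq_sum (q : ℕ) (f : MvPolynomial (Fin d) k) (α : Fin d →₀ ℕ) :
    Jcomp q f α = Finsupp.sum (AddMonoidAlgebra.coeff f) fun γ c =>
      if ∀ i, γ i % q = α i then monomial (γ - α) c else 0 := by
  rw [Jcomp, Finset.sum_filter]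
  rfl

theorem Jcomp_monomial (q : ℕ) (γ α : Fin d →₀ ℕ) (c : k) :
    Jcomp q (monomial γ c) α =
      if ∀ i, γ i % q = α i then monomial (γ - α) c else 0 := by
  rw [Jcomp_eq_sum]
  exact Finsupp.sum_single_index (by split_ifs <;> simp)

theorem Jcomp_pow_char (p : ℕ) [Fact p.Prime] [CharP k p] (q : ℕ)
    (g : MvPolynomial (Fin d) k) (α : Fin d →₀ ℕ) :
    Jcomp (p * q) (g ^ p) (p • α) = Jcomp q g α ^ p := by
  have hp : 0 < p := (Fact.out : p.Prime).pos
  induction g using MvPolynomial.induction_on' with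
  | add a b ha hb => rw [add_pow_char, Jcomp_add, Jcomp_add, add_pow_char, ha, hb]
  | monomial γ c =>
    have hiff : (∀ i, (p • γ) i % (p * q) = (p • α) i) ↔ ∀ i, γ i % q = α i := by
      simp [Nat.mul_mod_mul_left, hp.ne']
    have hsub : p • γ - p • α = p • (γ - α) := by
      ext i
      simp [Nat.mul_sub]
    rw [monomial_pow, Jcomp_monomial, Jcomp_monomial, hsub, ite_pow, monomial_pow,
      zero_pow hp.ne']
    simp only [hiff]

theorem Jcomp_pow_char_eq_zero (p : ℕ) [Fact p.Prime] [CharP k p] (q : ℕ)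
    (g : MvPolynomial (Fin d) k) (α : Fin d →₀ ℕ) (i : Fin d) (hi : ¬ p ∣ α i) :
    Jcomp (p * q) (g ^ p) α = 0 := by
  induction g using MvPolynomial.induction_on' with
  | add a b ha hb => rw [add_pow_char, Jcomp_add, ha, hb, add_zero]
  | monomial γ c =>
    rw [monomial_pow, Jcomp_monomial, if_neg]
    intro h
    apply hi
    rw [← h i, Finsupp.smul_apply, smul_eq_mul, Nat.mul_mod_mul_left]
    exact dvd_mul_right _ _

theorem frobPow_span (p : ℕ) [Fact p.Prime] [CharP k p] (s : Set (MvPolynomial (Fin d) k)) :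
    frobPow (Ideal.span s) p = Ideal.span ((fun x => x ^ p) '' s) :=
  Ideal.map_span (frobenius (MvPolynomial (Fin d) k) p) s

/-- if `f = g^p` then `J_n(f) = J_{n-1}(g)^{[p]}`. -/
theorem stmt7 (p : ℕ) [Fact p.Prime] (k : Type*) [Field k] [CharP k p]
    (d n : ℕ) (hn : 1 ≤ n) (f g : MvPolynomial (Fin d) k) (hfg : f = g ^ p) :
    Jideal (p ^ n) f = frobPow (Jideal (p ^ (n - 1)) g) p := by
  have hp : 0 < p := (Fact.out : p.Prime).pos
  obtain ⟨m, rfl⟩ := Nat.exists_eq_add_of_le' hn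
  subst hfg
  rw [Nat.add_sub_cancel, pow_succ', Jideal, Jideal, frobPow_span]
  apply le_antisymm <;> rw [Ideal.span_le]
  · rintro _ ⟨α, hα, rfl⟩
    by_cases hdvd : ∀ i, p ∣ α i
    · choose β hβ using hdvd
      have hαβ : α = p • Finsupp.equivFunOnFinite.symm β := by
        ext i
        simp [hβ]
      subst hαβ
      rw [Jcomp_pow_char]
      refine Ideal.subset_span ⟨_, ⟨_, fun i => ?_, rfl⟩, rfl⟩
      exact lt_of_mul_lt_mul_left (hα i) hp.le
    · push Not at hdvd
      obtain ⟨i, hi⟩ := hdvd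
      rw [Jcomp_pow_char_eq_zero p _ g α i hi]
      exact zero_mem _
  · rintro _ ⟨_, ⟨α, hα, rfl⟩, rfl⟩
    exact Ideal.subset_span
      ⟨p • α, fun i => Nat.mul_lt_mul_of_pos_left (hα i) hp, (Jcomp_pow_char p _ g α).symm⟩
end
end

section
/- Let k be a field of characteristic p > 0, let R = k[x_1, ..., x_d], let n ≥ 1, and let f ∈ R. Then J_n(f) equals the ideal of R generated by the polynomials D_β(f), as β ranges over all multi-indices in ℕ^d with every component strictly less than p^n. -/
open MvPolynomial

noncomputable section

variable {k : Type*} [Field k] {d : ℕ}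

/-- A case of Lucas' theorem for prime powers: if `b < p ^ n`, then `m.choose b` modulo `p`
depends only on `m` modulo `p ^ n`. -/
theorem choose_modEq_mod_pow_choose {p : ℕ} [Fact p.Prime] {n b : ℕ} (m : ℕ) (hb : b < p ^ n) :
    m.choose b ≡ (m % p ^ n).choose b [MOD p] := by
  induction n generalizing m b with
  | zero =>
    obtain rfl : b = 0 := by simpa using hb
    simp [Nat.ModEq.refl]
  | succ n ih =>
    have hb' : b / p < p ^ n := Nat.div_lt_of_lt_mul (by rwa [pow_succ'] at hb)
    have h1 := Choose.choose_modEq_choose_mod_mul_choose_div_nat (n := m) (k := b) (p := p)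
    have h2 := Choose.choose_modEq_choose_mod_mul_choose_div_nat
      (n := m % p ^ (n + 1)) (k := b) (p := p)
    rw [pow_succ', Nat.mod_mul_right_mod, Nat.mod_mul_right_div_self] at h2
    rw [pow_succ']
    exact h1.trans (((ih _ hb').mul_left _).trans h2.symm)

/-- The componentwise residue of a multi-index modulo `q`. -/
def modIndex (q : ℕ) (γ : Fin d →₀ ℕ) : Fin d →₀ ℕ :=
  γ.mapRange (· % q) (Nat.zero_mod q)

/-- The multi-index all of whose components equal `q - 1`. -/
def topIndex (q d : ℕ) : Fin d →₀ ℕ :=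
  Finsupp.equivFunOnFinite.symm fun _ => q - 1

theorem mem_Iic_topIndex {q : ℕ} (hq : 0 < q) {α : Fin d →₀ ℕ} :
    α ∈ Finset.Iic (topIndex q d) ↔ ∀ i, α i < q := by
  rw [Finset.mem_Iic, Finsupp.le_def]
  exact forall_congr' fun i => Nat.le_sub_one_iff_lt hq

theorem prod_choose_eq_zero {α β : Fin d →₀ ℕ} (h : ¬β ≤ α) :
    ∏ i, (α i).choose (β i) = 0 := by
  obtain ⟨i, hi⟩ : ∃ i, α i < β i := by simpa [Finsupp.le_def] using h
  exact Finset.prod_eq_zero (Finset.mem_univ i) (Nat.choose_eq_zero_of_lt hi)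

theorem choose_smul_monomial_sub {p : ℕ} [Fact p.Prime] [CharP k p] {n : ℕ} {β γ : Fin d →₀ ℕ}
    (hβ : ∀ i, β i < p ^ n) (c : k) :
    (∏ i, (γ i).choose (β i)) • monomial (γ - β) c
      = (∏ i, (modIndex (p ^ n) γ i).choose (β i)) • monomial (modIndex (p ^ n) γ - β) (1 : k)
        * monomial (γ - modIndex (p ^ n) γ) c := by
  have hcast : ((∏ i, (γ i).choose (β i) : ℕ) : k)
      = (∏ i, (modIndex (p ^ n) γ i).choose (β i) : ℕ) := by
    push_cast
    exact Finset.prod_congr rfl fun i _ =>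
      (CharP.natCast_eq_natCast k p).2 (choose_modEq_mod_pow_choose (γ i) (hβ i))
  rw [← Nat.cast_smul_eq_nsmul k, ← Nat.cast_smul_eq_nsmul k, hcast]
  by_cases hle : β ≤ modIndex (p ^ n) γ
  · have hmod : modIndex (p ^ n) γ ≤ γ := fun i => Nat.mod_le _ _
    rw [smul_mul_assoc, monomial_mul, one_mul, add_comm (_ - β), tsub_add_tsub_cancel hmod hle]
  · rw [prod_choose_eq_zero hle, Nat.cast_zero, zero_smul, zero_smul, zero_mul]

theorem Dop_eq_sum_Jcomp {p : ℕ} [Fact p.Prime] [CharP k p] {n : ℕ} {β : Fin d →₀ ℕ}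
    (hβ : ∀ i, β i < p ^ n) (f : MvPolynomial (Fin d) k) :
    Dop β f = ∑ α ∈ Finset.Iic (topIndex (p ^ n) d),
      (∏ i, (α i).choose (β i)) • monomial (α - β) 1 * Jcomp (p ^ n) f α := by
  have hq : 0 < p ^ n := pow_pos (Fact.out : p.Prime).pos n
  rw [Dop, ← Finset.sum_fiberwise_of_maps_to (g := modIndex (p ^ n))
    fun γ _ => (mem_Iic_topIndex hq).2 fun i => Nat.mod_lt _ hq]
  refine Finset.sum_congr rfl fun α _ => ?_
  rw [Jcomp, Finset.mul_sum]
  refine Finset.sum_congr (Finset.filter_congr fun γ _ => Finsupp.ext_iff) fun γ hγ => ?_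
  obtain rfl : modIndex (p ^ n) γ = α := Finsupp.ext (Finset.mem_filter.1 hγ).2
  exact choose_smul_monomial_sub hβ _

theorem Jcomp_mem_span_Dop {p : ℕ} [Fact p.Prime] [CharP k p] {n : ℕ}
    (f : MvPolynomial (Fin d) k) {β : Fin d →₀ ℕ} (hβ : ∀ i, β i < p ^ n) :
    Jcomp (p ^ n) f β
      ∈ Ideal.span { g | ∃ β : Fin d →₀ ℕ, (∀ i, β i < p ^ n) ∧ g = Dop β f } := by
  have hq : 0 < p ^ n := pow_pos (Fact.out : p.Prime).pos n
  induction hN : ∑ i, (p ^ n - β i) using Nat.strong_induction_on generalizing β with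
  | _ N ih =>
    have hsum := Dop_eq_sum_Jcomp hβ f
    rw [← Finset.add_sum_erase _ _ ((mem_Iic_topIndex hq).2 hβ)] at hsum
    have hdiag : (∏ i, (β i).choose (β i)) • monomial (β - β) (1 : k) * Jcomp (p ^ n) f β
        = Jcomp (p ^ n) f β := by
      simp
    rw [hdiag] at hsum
    rw [← sub_eq_of_eq_add hsum]
    refine Ideal.sub_mem _ (Ideal.subset_span ⟨β, hβ, rfl⟩) (Ideal.sum_mem _ fun α hα => ?_)
    obtain ⟨hne, hα⟩ := Finset.mem_erase.1 hα
    rw [mem_Iic_topIndex hq] at hα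
    by_cases hle : β ≤ α
    · refine Ideal.mul_mem_left _ _ (ih _ ?_ hα rfl)
      obtain ⟨i, hi⟩ : ∃ i, β i < α i := by
        by_contra! h
        exact hne (le_antisymm h hle)
      rw [← hN]
      exact Finset.sum_lt_sum (fun j _ => Nat.sub_le_sub_left (hle j) _)
        ⟨i, Finset.mem_univ i, Nat.sub_lt_sub_left (hβ i) hi⟩
    · rw [prod_choose_eq_zero hle, zero_smul, zero_mul]
      exact Ideal.zero_mem _

/-- `J_n(f)` equals the ideal generated by the `D_β(f)` for multi-indices
`β` with all components `< p^n`. -/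
theorem stmt8 (p : ℕ) [Fact p.Prime] (k : Type*) [Field k] [CharP k p]
    (d n : ℕ) (hn : 1 ≤ n) (f : MvPolynomial (Fin d) k) :
    Jideal (p ^ n) f
      = Ideal.span { g | ∃ β : Fin d →₀ ℕ, (∀ i, β i < p ^ n) ∧ g = Dop β f } := by
  have hq : 0 < p ^ n := pow_pos (Fact.out : p.Prime).pos n
  apply le_antisymm
  · refine Ideal.span_le.2 ?_
    rintro _ ⟨α, hα, rfl⟩
    exact Jcomp_mem_span_Dop f hα
  · refine Ideal.span_le.2 ?_
    rintro _ ⟨β, hβ, rfl⟩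
    rw [SetLike.mem_coe, Dop_eq_sum_Jcomp hβ f]
    exact Ideal.sum_mem _ fun α hα => Ideal.mul_mem_left _ _
      (Ideal.subset_span ⟨α, (mem_Iic_topIndex hq).1 hα, rfl⟩)
end
end

section
/- Let k be a field of characteristic p > 0 and let R = k[x_1, ..., x_d]. If I and J are ideals of R and n ≥ 0 is an integer such that the Frobenius powers satisfy I^{[p^n]} ⊆ J^{[p^n]}, then I ⊆ J. In particular, I^{[p^n]} = J^{[p^n]} implies I = J. -/
open MvPolynomial

noncomputable section

variable {k : Type*} [Field k] {d : ℕ}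

/-- A ring homomorphism out of a field into a nontrivial ring splits: it has an additive retraction
that is linear over the source. -/
lemma exists_linear_retraction {K L : Type*} [Field K] [CommRing L] [Nontrivial L] (F : K →+* L) :
    ∃ φ : L →+ K, φ 1 = 1 ∧ ∀ c a, φ (F c * a) = c * φ a := by
  let _ := F.toAlgebra
  obtain ⟨g, hg⟩ := (Algebra.linearMap K L).exists_leftInverse_of_injective
    (LinearMap.ker_eq_bot.2 F.injective)
  refine ⟨g.toAddMonoidHom, ?_, fun c a => ?_⟩
  · simpa using LinearMap.congr_fun hg 1
  · have h := g.map_smul c a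
    rwa [Algebra.smul_def, smul_eq_mul] at h

/-- Extracting the coefficients whose exponents are multiples of `q`, and applying `φ` to them. -/
lemma exists_coeff_smul_eq {σ R S : Type*} [CommSemiring R] [CommSemiring S] {q : ℕ} (hq : q ≠ 0)
    (φ : R →+ S) :
    ∃ T : MvPolynomial σ R → MvPolynomial σ S, ∀ f γ, coeff γ (T f) = φ (coeff (q • γ) f) := by
  classical
  have hinj : Function.Injective (fun γ : σ →₀ ℕ => q • γ) := fun a b h => by
    ext i
    exact Nat.eq_of_mul_eq_mul_left (Nat.pos_of_ne_zero hq) (by simpa using DFunLike.congr_fun h i)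
  refine ⟨fun f => ∑ γ ∈ f.support.preimage _ hinj.injOn, monomial γ (φ (coeff (q • γ) f)),
    fun f γ => ?_⟩
  simp only [coeff_sum, coeff_monomial, Finset.sum_ite_eq', Finset.mem_preimage, mem_support_iff,
    ite_eq_left_iff, not_not]
  intro h
  rw [h, map_zero]

/-- In characteristic `p`, the `p ^ n`-power map on a polynomial ring over a field splits. -/
lemma exists_frobenius_retraction (p : ℕ) [Fact p.Prime] (k : Type*) [Field k] [CharP k p]
    (σ : Type*) (n : ℕ) :
    ∃ T : MvPolynomial σ k →+ MvPolynomial σ k, T 1 = 1 ∧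
      ∀ g h, T (g ^ p ^ n * h) = g * T h := by
  classical
  have hq : p ^ n ≠ 0 := pow_ne_zero _ (Fact.out : p.Prime).ne_zero
  obtain ⟨φ, hφ1, hφ⟩ := exists_linear_retraction (iterateFrobenius k p n)
  obtain ⟨T, hT⟩ := exists_coeff_smul_eq (σ := σ) hq φ
  have hadd : ∀ f g, T (f + g) = T f + T g := fun f g => by ext γ; simp [hT]
  refine ⟨AddMonoidHom.mk' T hadd, ?_, fun g h => ?_⟩
  · ext γ
    have : (0 = p ^ n • γ) ↔ 0 = γ := by
      rw [eq_comm, smul_eq_zero, or_iff_right hq, eq_comm]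
    simp only [AddMonoidHom.mk'_apply, hT, coeff_one, this]
    split_ifs <;> simp [hφ1]
  · simp only [AddMonoidHom.mk'_apply]
    induction g using MvPolynomial.induction_on' with
    | add f g hf hg => rw [add_pow_char_pow, add_mul, hadd, hf, hg, add_mul]
    | monomial m c =>
      ext γ
      have hle : p ^ n • m ≤ p ^ n • γ ↔ m ≤ γ := by
        simp only [Finsupp.le_def, Finsupp.smul_apply, smul_eq_mul]
        exact forall_congr' fun i => Nat.mul_le_mul_left_iff (Nat.pos_of_ne_zero hq)
      have hsub : p ^ n • γ - p ^ n • m = p ^ n • (γ - m) := by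
        ext i
        simp [Nat.mul_sub]
      rw [hT, monomial_pow, coeff_monomial_mul', coeff_monomial_mul', hT]
      simp only [hle, hsub]
      split_ifs
      · exact hφ c _
      · exact map_zero φ

/-- Containment of Frobenius powers descends to the ideals themselves. -/
lemma le_of_frobPow_le (p : ℕ) [Fact p.Prime] {k : Type*} [Field k] [CharP k p] {d n : ℕ}
    {I J : Ideal (MvPolynomial (Fin d) k)} (h : frobPow I (p ^ n) ≤ frobPow J (p ^ n)) :
    I ≤ J := by
  obtain ⟨T, hT1, hT⟩ := exists_frobenius_retraction p k (Fin d) n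
  have hTJ : ∀ f ∈ frobPow J (p ^ n), T f ∈ J := fun f hf => by
    induction hf using Submodule.closure_induction with
    | zero => simp
    | add x y _ _ hx hy => simpa using J.add_mem hx hy
    | smul_mem a x hx =>
      obtain ⟨g, hg, rfl⟩ := hx
      rw [smul_eq_mul, mul_comm, hT]
      exact J.mul_mem_right _ hg
  intro f hf
  have hTf : T (f ^ p ^ n) = f := by simpa [hT1] using hT f 1
  exact hTf ▸ hTJ _ (h (Ideal.subset_span ⟨f, hf, rfl⟩))

/-- `I^{[p^n]} ⊆ J^{[p^n]}` implies `I ⊆ J`; in particular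
`I^{[p^n]} = J^{[p^n]}` implies `I = J`. -/
theorem stmt12 (p : ℕ) [Fact p.Prime] (k : Type*) [Field k] [CharP k p]
    (d n : ℕ) (I J : Ideal (MvPolynomial (Fin d) k)) :
    (frobPow I (p ^ n) ≤ frobPow J (p ^ n) → I ≤ J) ∧
    (frobPow I (p ^ n) = frobPow J (p ^ n) → I = J) :=
  ⟨le_of_frobPow_le p, fun h => le_antisymm (le_of_frobPow_le p h.le) (le_of_frobPow_le p h.ge)⟩
end
end

section
/- Let p be a prime with p ≡ 1 (mod 4) and let k be a field of characteristic p. In R = k[x_1, x_2, x_3, x_4], the coefficient of the monomial x_1^{(p−1)/2} x_2^{(p−1)/2} x_3^{(p−1)/2} x_4^{(p−1)/2} in (x_1² + x_2² + x_3² + x_4²)^{p−1} equals the image in k of the multinomial coefficient (p−1)!/(((p−1)/4)!)^4, and this coefficient is nonzero in k. -/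
open MvPolynomial

noncomputable section

variable {k : Type*} [Field k] {d : ℕ}

/-- The coefficient of `∏ i, x_i ^ (m * a i)` in `(∑ i, x_i ^ m) ^ n` is a multinomial
coefficient. -/
theorem coeff_sum_X_pow_pow {σ R : Type*} [Fintype σ] [CommSemiring R] {m n : ℕ} (hm : m ≠ 0)
    (a : σ → ℕ) (ha : ∑ i, a i = n) :
    coeff (Finsupp.equivFunOnFinite.symm fun i => m * a i)
      ((∑ i, X i ^ m : MvPolynomial σ R) ^ n) = (Nat.multinomial Finset.univ a : R) := by
  classical
  have hmon (g : σ → ℕ) : (∏ i, (X i ^ m) ^ g i : MvPolynomial σ R) =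
      monomial (Finsupp.equivFunOnFinite.symm fun i => m * g i) 1 := by
    simp [monomial_eq, Finsupp.prod_fintype, pow_mul]
  have hinj (g : σ → ℕ) : (Finsupp.equivFunOnFinite.symm fun i => m * g i) =
      (Finsupp.equivFunOnFinite.symm fun i => m * a i) ↔ g = a := by
    simp [funext_iff, hm]
  rw [Finset.sum_pow_eq_sum_piAntidiag, coeff_sum]
  simp_rw [hmon, ← C_eq_coe_nat, coeff_C_mul, coeff_monomial, hinj, mul_ite, mul_one, mul_zero]
  rw [Finset.sum_ite_eq', if_pos (by simp [ha])]

/-- A multinomial coefficient with sum less than `p` is nonzero in characteristic `p`. -/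
theorem multinomial_cast_ne_zero {ι R : Type*} [AddMonoidWithOne R] {p : ℕ} [CharP R p]
    (hp : p.Prime) (s : Finset ι) (a : ι → ℕ) (ha : ∑ i ∈ s, a i < p) :
    (Nat.multinomial s a : R) ≠ 0 := by
  rw [Ne, CharP.cast_eq_zero_iff R p]
  intro h
  have hdvd : p ∣ (∑ i ∈ s, a i).factorial :=
    Nat.multinomial_spec s a ▸ h.mul_left _
  exact absurd (hp.dvd_factorial.mp hdvd) (by omega)

/-- for `p ≡ 1 (mod 4)`, the coefficient of
`x_1^{(p-1)/2} x_2^{(p-1)/2} x_3^{(p-1)/2} x_4^{(p-1)/2}` in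
`(x_1² + x_2² + x_3² + x_4²)^(p-1)` is the image in `k` of `(p-1)!/(((p-1)/4)!)^4`,
and it is nonzero. -/
theorem stmt16 (p : ℕ) (hp : p.Prime) (hp4 : p % 4 = 1) (k : Type*) [Field k] [CharP k p] :
    coeff (Finsupp.equivFunOnFinite.symm fun _ : Fin 4 => (p - 1) / 2)
        ((X 0 ^ 2 + X 1 ^ 2 + X 2 ^ 2 + X 3 ^ 2 : MvPolynomial (Fin 4) k) ^ (p - 1))
      = (((p - 1).factorial / ((p - 1) / 4).factorial ^ 4 : ℕ) : k) ∧
    (((p - 1).factorial / ((p - 1) / 4).factorial ^ 4 : ℕ) : k) ≠ 0 := by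
  have hsum : ∑ _i : Fin 4, (p - 1) / 4 = p - 1 := by
    simp only [Finset.sum_const, Finset.card_univ, Fintype.card_fin, smul_eq_mul]
    omega
  have hmult : Nat.multinomial Finset.univ (fun _ : Fin 4 => (p - 1) / 4) =
      (p - 1).factorial / ((p - 1) / 4).factorial ^ 4 := by
    simp [Nat.multinomial, show 4 * ((p - 1) / 4) = p - 1 by omega]
  have hcoeff := coeff_sum_X_pow_pow (R := k) two_ne_zero (fun _ : Fin 4 => (p - 1) / 4) hsum
  have hhalf : 2 * ((p - 1) / 4) = (p - 1) / 2 := by omega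
  rw [← hmult]
  refine ⟨?_, multinomial_cast_ne_zero hp _ _ (hsum.trans_lt (Nat.sub_lt hp.pos one_pos))⟩
  simpa only [Fin.sum_univ_four, hhalf] using hcoeff
end
end
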